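/- For every β ∈ (0,1), sup_{0 < x < 1} x·(−ln x)^{β+1} / (1−x)^{β+1} = 1; in particular, x·(−ln x)^{β+1} ≤ (1−x)^{β+1} for all x ∈ (0,1). -/

import Mathlib

/-- The logarithmic mean inequality `√x · (-log x) ≤ 1 - x`, in squared form. -/
theorem mul_neg_log_sq_le_one_sub_sq {x : ℝ} (hx : x ∈ Set.Ioo (0:ℝ) 1) :
    x * (-Real.log x) ^ 2 ≤ (1 - x) ^ 2 := by
  obtain ⟨t, ht, rfl⟩ : ∃ t : ℝ, 0 < t ∧ Real.exp (-t) ^ 2 = x := by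
    refine ⟨-Real.log x / 2, by linarith [Real.log_neg hx.1 hx.2], ?_⟩
    rw [← Real.exp_nat_mul]
    convert Real.exp_log hx.1 using 2
    push_cast
    ring
  have hsinh : t ≤ Real.sinh t := Real.self_le_sinh_iff.2 ht.le
  rw [Real.sinh_eq] at hsinh
  have hexp : Real.exp t * Real.exp (-t) = 1 := by rw [← Real.exp_add]; simp
  have key : Real.exp (-t) * (2 * t) ≤ 1 - Real.exp (-t) ^ 2 := by
    nlinarith [mul_le_mul_of_nonneg_right hsinh (Real.exp_pos (-t)).le]
  rw [Real.log_pow, Real.log_exp]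
  calc Real.exp (-t) ^ 2 * (-((2 : ℕ) * -t)) ^ 2 = (Real.exp (-t) * (2 * t)) ^ 2 := by
        push_cast; ring
    _ ≤ (1 - Real.exp (-t) ^ 2) ^ 2 := by gcongr

/-- On `(0, 1)` the ratio `(-log x) / (1 - x)` is at least `1`. -/
theorem one_le_neg_log_div_one_sub {x : ℝ} (hx : x ∈ Set.Ioo (0:ℝ) 1) :
    1 ≤ -Real.log x / (1 - x) := by
  rw [one_le_div (sub_pos.2 hx.2)]
  linarith [Real.log_le_sub_one_of_pos hx.1]

theorem mul_neg_log_rpow_div_eq {x : ℝ} (hx : x ∈ Set.Ioo (0:ℝ) 1) (p : ℝ) :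
    x * (-Real.log x) ^ p / (1 - x) ^ p = x * (-Real.log x / (1 - x)) ^ p := by
  rw [Real.div_rpow (neg_nonneg.2 (Real.log_neg hx.1 hx.2).le) (sub_pos.2 hx.2).le, mul_div_assoc]

theorem mul_neg_log_rpow_div_le_one {x p : ℝ} (hx : x ∈ Set.Ioo (0:ℝ) 1) (hp : p ≤ 2) :
    x * (-Real.log x) ^ p / (1 - x) ^ p ≤ 1 := by
  have hx1 : 0 < 1 - x := sub_pos.2 hx.2
  rw [mul_neg_log_rpow_div_eq hx]
  calc x * (-Real.log x / (1 - x)) ^ p ≤ x * (-Real.log x / (1 - x)) ^ (2 : ℝ) :=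
        mul_le_mul_of_nonneg_left
          (Real.rpow_le_rpow_of_exponent_le (one_le_neg_log_div_one_sub hx) hp) hx.1.le
    _ ≤ 1 := by
        rw [Real.rpow_two, div_pow, ← mul_div_assoc, div_le_one (by positivity)]
        exact mul_neg_log_sq_le_one_sub_sq hx

theorem le_mul_neg_log_rpow_div {x p : ℝ} (hx : x ∈ Set.Ioo (0:ℝ) 1) (hp : 0 ≤ p) :
    x ≤ x * (-Real.log x) ^ p / (1 - x) ^ p := by
  rw [mul_neg_log_rpow_div_eq hx]
  exact le_mul_of_one_le_right hx.1.le (Real.one_le_rpow (one_le_neg_log_div_one_sub hx) hp)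

/-- For every `β ∈ (0,1)`,
`sup_{0<x<1} x·(−ln x)^{β+1}/(1−x)^{β+1} = 1`; in particular
`x·(−ln x)^{β+1} ≤ (1−x)^{β+1}` for all `x ∈ (0,1)`. -/
theorem sup_x_negLog_pow_div_one_sub_pow
    (β : ℝ) (hβ : β ∈ Set.Ioo (0:ℝ) 1) :
    sSup ((fun x : ℝ => x * (-Real.log x) ^ (β + 1) / (1 - x) ^ (β + 1)) ''
        Set.Ioo (0:ℝ) 1) = 1 ∧
      ∀ x ∈ Set.Ioo (0:ℝ) 1, x * (-Real.log x) ^ (β + 1) ≤ (1 - x) ^ (β + 1) := by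
  have hp0 : 0 ≤ β + 1 := by linarith [hβ.1]
  have hp2 : β + 1 ≤ 2 := by linarith [hβ.2]
  refine ⟨csSup_eq_of_forall_le_of_forall_lt_exists_gt ?_ ?_ ?_, fun x hx => ?_⟩
  · exact (Set.nonempty_Ioo.2 one_pos).image _
  · rintro _ ⟨x, hx, rfl⟩
    exact mul_neg_log_rpow_div_le_one hx hp2
  · intro w hw
    obtain ⟨x, hwx, hx1⟩ := exists_between (max_lt hw one_pos)
    have hx : x ∈ Set.Ioo (0:ℝ) 1 := ⟨(le_max_right _ _).trans_lt hwx, hx1⟩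
    exact ⟨_, ⟨x, hx, rfl⟩,
      ((le_max_left _ _).trans_lt hwx).trans_le (le_mul_neg_log_rpow_div hx hp0)⟩
  · exact (div_le_one (Real.rpow_pos_of_pos (sub_pos.2 hx.2) _)).1
      (mul_neg_log_rpow_div_le_one hx hp2)
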